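/- For any balanced atomic measures $\lambda^\pm$ and $n \in \mathbb{N}$, the infimum $\inf_{\mu \in \mathcal{B}^{+,n}} W_q(\mu + \lambda^+, \mu + \lambda^-)$ is attained by some $\mu_n \in \mathcal{B}^{+,n}$. -/

import Mathlib

open Finset Real
open scoped Classical

/-- First marginal of a finitely supported plan. -/
noncomputable def margFst {X : Type*} (pl : (X × X) →₀ ℝ) : X →₀ ℝ :=
  pl.sum fun p w => Finsupp.single p.1 w

/-- Second marginal of a finitely supported plan. -/
noncomputable def margSnd {X : Type*} (pl : (X × X) →₀ ℝ) : X →₀ ℝ :=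
  pl.sum fun p w => Finsupp.single p.2 w

/-- `q`-th power Wasserstein cost between finitely supported measures:
`W_q(μ,ν)^q = inf ∑ pl_{u,v} dist(u,v)^q` over nonnegative couplings. -/
noncomputable def WqCost {X : Type*} [PseudoMetricSpace X] (q : ℝ)
    (μ ν : X →₀ ℝ) : ℝ :=
  sInf { c | ∃ pl : (X × X) →₀ ℝ, (∀ p, 0 ≤ pl p) ∧
    margFst pl = μ ∧ margSnd pl = ν ∧
    c = ∑ p ∈ pl.support, pl p * dist p.1 p.2 ^ q }

/-- The atomic measure `∑ mᵢ δ_{xᵢ}`. -/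
noncomputable def atomicMeasure {X : Type*} {N : ℕ} (x : Fin N → X)
    (m : Fin N → ℝ) : X →₀ ℝ :=
  ∑ i, Finsupp.single (x i) (m i)

/-- `W̄_q^{(n)}(λ⁺,λ⁻) = inf_{μ ∈ B^{+,n}} W_q(μ+λ⁺, μ+λ⁻)`. -/
noncomputable def barW {X : Type*} [PseudoMetricSpace X] (q : ℝ) (n : ℕ)
    (lp lm : X →₀ ℝ) : ℝ :=
  sInf { c | ∃ μ : X →₀ ℝ, (∀ z, 0 ≤ μ z) ∧ μ.support.card ≤ n ∧
    c = WqCost q (μ + lp) (μ + lm) ^ (1 / q) }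

/-- The conditions defining `Γ(λ)`: a finite weighted directed graph with
straight edges, prescribed out-flow `m i` at each source `x i`, in-flow
`ms i` at each sink `y i`, and Kirchhoff balance at all other vertices. -/
def IsNetworkFor {X : Type*} {N : ℕ} (x y : Fin N → X) (m ms : Fin N → ℝ)
    (E : Finset (X × X)) (w : X × X → ℝ) : Prop :=
  (∀ e ∈ E, 0 < w e) ∧
  (∀ i, ∑ e ∈ E.filter (fun e => e.1 = x i), w e = m i) ∧
  (∀ i, ∑ e ∈ E.filter (fun e => e.2 = y i), w e = ms i) ∧
  (∀ v, (∀ i, v ≠ x i) → (∀ i, v ≠ y i) →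
    ∑ e ∈ E.filter (fun e => e.1 = v), w e =
      ∑ e ∈ E.filter (fun e => e.2 = v), w e)

/-- The branched-transport network cost `Ŵ^{(q)}(λ) = inf ∑ |e| m_e^{1/q}`. -/
noncomputable def hatW {X : Type*} [PseudoMetricSpace X] (q : ℝ) {N : ℕ}
    (x y : Fin N → X) (m ms : Fin N → ℝ) : ℝ :=
  sInf { c | ∃ (E : Finset (X × X)) (w : X × X → ℝ),
    IsNetworkFor x y m ms E w ∧
    c = ∑ e ∈ E, dist e.1 e.2 * w e ^ (1 / q) }


namespace Aux15

def Feas {A B N : Type*} [Fintype A] [Fintype B] [Fintype N] (la : A → ℝ) (lb : B → ℝ)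
    (g : (A ⊕ N) → (B ⊕ N) → ℝ) : Prop :=
  (∀ u v, 0 ≤ g u v) ∧ (∀ a, ∑ v, g (Sum.inl a) v = la a) ∧
  (∀ b, ∑ u, g u (Sum.inl b) = lb b) ∧
  (∀ j, ∑ v, g (Sum.inr j) v = ∑ u, g u (Sum.inr j))

lemma path_flow {N : Type*} [Fintype N] (E : N → N → Prop) {a b : N}
    (h : Relation.ReflTransGen E a b) :
    ∃ f : N → N → ℝ, (∀ i j, 0 ≤ f i j) ∧ (∀ i j, f i j ≠ 0 → E i j) ∧
      ∀ j, ∑ v, f j v + (if j = b then 1 else 0) = ∑ u, f u j + (if j = a then 1 else 0) := by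
  induction h with
  | refl => exact ⟨fun _ _ => 0, by simp, by simp, by simp⟩
  | @tail b c _ hbc ih =>
    obtain ⟨f, h0, h1, h2⟩ := ih
    refine ⟨fun i j => f i j + (if i = b then (if j = c then 1 else 0) else 0), ?_, ?_, ?_⟩
    · intro i j
      have := h0 i j
      beta_reduce; split_ifs <;> linarith
    · intro i j hij
      by_cases hf : f i j = 0
      · by_cases hi : i = b
        · by_cases hj : j = c
          · rw [hi, hj]; exact hbc
          · simp [hf, hj] at hij
        · simp [hf, hi] at hij
      · exact h1 i j hf
    · intro j
      have := h2 j
      simp only [Finset.sum_add_distrib]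
      have e1 : ∑ v, (if j = b then (if v = c then (1:ℝ) else 0) else 0) = if j = b then 1 else 0 := by
        split_ifs <;> simp
      have e2 : ∑ u, (if u = b then (if j = c then (1:ℝ) else 0) else 0) = if j = c then 1 else 0 := by
        simp
      rw [e1, e2]
      linarith

lemma exists_eps {I J : Type*} [Fintype I] [Fintype J] (g f : I → J → ℝ)
    (hg : ∀ i j, 0 ≤ g i j) (hf : ∀ i j, f i j ≠ 0 → 0 < g i j) :
    ∃ e : ℝ, 0 < e ∧ ∀ i j, e * f i j ≤ g i j := by
  have : ∀ᶠ e : ℝ in nhdsWithin 0 (Set.Ioi 0), ∀ i j, e * f i j ≤ g i j := by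
    rw [Filter.eventually_all]; intro i
    rw [Filter.eventually_all]; intro j
    by_cases h : f i j = 0
    · simp [h, hg]
    · have hc : Filter.Tendsto (fun e : ℝ => e * f i j) (nhds 0) (nhds 0) := by
        have : Continuous (fun e : ℝ => e * f i j) := by fun_prop
        simpa using this.tendsto 0
      exact (((hc.eventually (gt_mem_nhds (hf i j h)))).filter_mono nhdsWithin_le_nhds).mono
        fun e he => he.le
  obtain ⟨e, h1, h2⟩ := (this.and self_mem_nhdsWithin).exists
  exact ⟨e, h2, h1⟩

lemma isClosed_feas {A B N : Type*} [Fintype A] [Fintype B] [Fintype N]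
    (la : A → ℝ) (lb : B → ℝ) : IsClosed {g : (A ⊕ N) → (B ⊕ N) → ℝ | Feas la lb g} := by
  simp only [Feas, Set.ofPred_and, Set.ofPred_forall]
  refine IsClosed.inter ?_ (IsClosed.inter ?_ (IsClosed.inter ?_ ?_))
  · exact isClosed_iInter fun u => isClosed_iInter fun v => isClosed_le (by fun_prop) (by fun_prop)
  · exact isClosed_iInter fun u => isClosed_eq (by fun_prop) (by fun_prop)
  · exact isClosed_iInter fun u => isClosed_eq (by fun_prop) (by fun_prop)
  · exact isClosed_iInter fun u => isClosed_eq (by fun_prop) (by fun_prop)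

lemma reduce {A B N : Type*} [Fintype A] [Fintype B] [Fintype N]
    (la : A → ℝ) (lb : B → ℝ) (g : (A ⊕ N) → (B ⊕ N) → ℝ) (hg : Feas la lb g) :
    ∃ g' : (A ⊕ N) → (B ⊕ N) → ℝ, Feas la lb g' ∧ (∀ u v, g' u v ≤ g u v) ∧
      ∀ u v, g' u v ≤ ∑ a, la a + ∑ b, lb b := by
  have hcomp : IsCompact (Set.Icc (0 : (A ⊕ N) → (B ⊕ N) → ℝ) g ∩ {g | Feas la lb g}) :=
    isCompact_Icc.inter_right (isClosed_feas la lb)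
  obtain ⟨m, ⟨⟨hm0, hmg⟩, hmF⟩, hmin⟩ := hcomp.exists_isMinOn
    (f := fun g : (A ⊕ N) → (B ⊕ N) → ℝ => ∑ u, ∑ v, g u v)
    ⟨g, ⟨fun u v => hg.1 u v, le_refl _⟩, hg⟩ (by fun_prop)
  have hmF' : Feas la lb m := hmF
  obtain ⟨p0, pa, pb, pn⟩ := hmF
  have hla : ∀ a, 0 ≤ la a := fun a => pa a ▸ Finset.sum_nonneg fun v _ => p0 _ v
  have hlb : ∀ b, 0 ≤ lb b := fun b => pb b ▸ Finset.sum_nonneg fun v _ => p0 v _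
  have hA : 0 ≤ ∑ a, la a := Finset.sum_nonneg fun a _ => hla a
  have hB : 0 ≤ ∑ a, lb a := Finset.sum_nonneg fun a _ => hlb a
  refine ⟨m, hmF', fun u v => hmg u v, ?_⟩
  have hL : ∀ a v, m (Sum.inl a) v ≤ ∑ a, la a + ∑ b, lb b := by
    intro a v
    have h1 : m (Sum.inl a) v ≤ la a := by
      rw [← pa a]
      exact Finset.single_le_sum (f := fun v => m (Sum.inl a) v) (fun v _ => p0 _ v)
        (Finset.mem_univ v)
    have h2 : la a ≤ ∑ a, la a :=
      Finset.single_le_sum (f := la) (fun v _ => hla v) (Finset.mem_univ a)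
    linarith
  have hR : ∀ u b, m u (Sum.inl b) ≤ ∑ a, la a + ∑ b, lb b := by
    intro u b
    have h1 : m u (Sum.inl b) ≤ lb b := by
      rw [← pb b]
      exact Finset.single_le_sum (f := fun u => m u (Sum.inl b)) (fun v _ => p0 v _)
        (Finset.mem_univ u)
    have h2 : lb b ≤ ∑ a, lb a :=
      Finset.single_le_sum (f := lb) (fun v _ => hlb v) (Finset.mem_univ b)
    linarith
  intro u v
  rcases u with a | j0
  · exact hL a v
  rcases v with b | j1
  · exact hR _ b
  rcases (p0 (Sum.inr j0) (Sum.inr j1)).eq_or_lt with h0 | hpos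
  · rw [← h0]; linarith
  let E : N → N → Prop := fun i j => 0 < m (Sum.inr i) (Sum.inr j)
  let S : Finset N := Finset.univ.filter fun j => Relation.ReflTransGen E j1 j
  have hj1 : j1 ∈ S := by simp [S, Relation.ReflTransGen.refl]
  have hj0 : j0 ∉ S := by
    intro hmem
    have hpath : Relation.ReflTransGen E j1 j0 := by simpa [S] using hmem
    obtain ⟨f, f0, fE, fb⟩ := path_flow E hpath
    obtain ⟨e, he, hle⟩ := exists_eps (fun i j => m (Sum.inr i) (Sum.inr j))
      (fun i j => f i j + (if i = j0 then (if j = j1 then 1 else 0) else 0))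
      (fun i j => p0 _ _) (by
        intro i j hij
        by_cases hf : f i j = 0
        · by_cases hi : i = j0
          · by_cases hj : j = j1
            · rw [hi, hj]; exact hpos
            · simp [hf, hj] at hij
          · simp [hf, hi] at hij
        · exact fE i j hf)
    let c : N → N → ℝ := fun i j => f i j + (if i = j0 then (if j = j1 then 1 else 0) else 0)
    have c0 : ∀ i j, 0 ≤ c i j := by
      intro i j
      have := f0 i j
      simp only [c]
      split_ifs <;> linarith
    have cc : c j0 j1 = f j0 j1 + 1 := by simp [c]
    have cb : ∀ j, ∑ v, c j v = ∑ u, c u j := by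
      intro j
      have := fb j
      simp only [c, Finset.sum_add_distrib]
      have e1 : ∑ v, (if j = j0 then (if v = j1 then (1:ℝ) else 0) else 0)
          = if j = j0 then 1 else 0 := by
        split_ifs <;> simp
      have e2 : ∑ u, (if u = j0 then (if j = j1 then (1:ℝ) else 0) else 0)
          = if j = j1 then 1 else 0 := by
        simp
      rw [e1, e2]
      linarith
    let D : (A ⊕ N) → (B ⊕ N) → ℝ := Sum.elim (fun _ _ => 0) (fun i => Sum.elim (fun _ => 0) (c i))
    have D0 : ∀ u v, 0 ≤ D u v := by
      rintro (a | i) (b | j) <;> simp [D, c0]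
    have Dm : ∀ u v, e * D u v ≤ m u v := by
      rintro (a | i) (b | j)
      · simpa [D] using p0 _ _
      · simpa [D] using p0 _ _
      · simpa [D] using p0 _ _
      · simpa [D] using hle i j
    have hnew : (fun u v => m u v - e * D u v) ∈
        Set.Icc (0 : (A ⊕ N) → (B ⊕ N) → ℝ) g ∩ {g | Feas la lb g} := by
      refine ⟨⟨fun u v => ?_, fun u v => ?_⟩, ?_, ?_, ?_, ?_⟩
      · have := Dm u v
        simp only [Pi.zero_apply]; linarith
      · have := mul_nonneg he.le (D0 u v)
        have := hmg u v
        simp only; linarith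
      · intro u v
        have := Dm u v
        simp only; linarith
      · intro a
        rw [← pa a]; simp [D]
      · intro b
        rw [← pb b]; simp [D]
      · intro j
        have h1 := pn j
        have h2 := cb j
        simp only [Finset.sum_sub_distrib, ← Finset.mul_sum]
        rw [h1]
        congr 2
        simpa [D] using h2
    have hlt := hmin hnew
    simp only [Set.mem_ofPred_eq, Finset.sum_sub_distrib, ← Finset.mul_sum] at hlt
    have hD : 1 ≤ ∑ u, ∑ v, D u v := by
      have h1 : D (Sum.inr j0) (Sum.inr j1) ≤ ∑ v, D (Sum.inr j0) v :=
        Finset.single_le_sum (f := fun v => D (Sum.inr j0) v) (fun v _ => D0 _ v)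
          (Finset.mem_univ _)
      have h2 : ∑ v, D (Sum.inr j0) v ≤ ∑ u, ∑ v, D u v :=
        Finset.single_le_sum (f := fun u => ∑ v, D u v)
          (fun u _ => Finset.sum_nonneg fun v _ => D0 _ v) (Finset.mem_univ _)
      have h3 : D (Sum.inr j0) (Sum.inr j1) = f j0 j1 + 1 := by simpa [D] using cc
      have := f0 j0 j1
      linarith
    nlinarith
  have hout : ∀ i ∈ S, ∀ j, j ∉ S → m (Sum.inr i) (Sum.inr j) = 0 := by
    intro i hi j hj
    by_contra hne
    have hE : E i j := lt_of_le_of_ne (p0 _ _) (Ne.symm hne)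
    have : Relation.ReflTransGen E j1 i := by simpa [S] using hi
    exact hj (by simpa [S] using this.tail hE)
  have hsum : ∑ j ∈ S, ∑ v, m (Sum.inr j) v = ∑ j ∈ S, ∑ u, m u (Sum.inr j) :=
    Finset.sum_congr rfl fun j _ => pn j
  simp only [Fintype.sum_sum_type, Finset.sum_add_distrib] at hsum
  have q1 : ∑ j ∈ S, ∑ b, m (Sum.inr j) (Sum.inl b) ≤ ∑ b, lb b := by
    rw [Finset.sum_comm]
    refine Finset.sum_le_sum fun b _ => ?_
    rw [← pb b, Fintype.sum_sum_type]
    have h1 : 0 ≤ ∑ a, m (Sum.inl a) (Sum.inl b) := Finset.sum_nonneg fun a _ => p0 _ _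
    have h2 : ∑ j ∈ S, m (Sum.inr j) (Sum.inl b) ≤ ∑ j, m (Sum.inr j) (Sum.inl b) :=
      Finset.sum_le_univ_sum_of_nonneg fun j => p0 _ _
    linarith
  have q2 : ∑ j ∈ S, ∑ j', m (Sum.inr j) (Sum.inr j')
      = ∑ j ∈ S, ∑ j' ∈ S, m (Sum.inr j) (Sum.inr j') := by
    refine Finset.sum_congr rfl fun j hj => ?_
    exact (Finset.sum_subset (Finset.subset_univ S) fun j' _ hj' => hout j hj j' hj').symm
  have q3 : 0 ≤ ∑ j ∈ S, ∑ a, m (Sum.inl a) (Sum.inr j) :=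
    Finset.sum_nonneg fun j _ => Finset.sum_nonneg fun a _ => p0 _ _
  have q4 : ∑ j ∈ S, ∑ i ∈ S, m (Sum.inr i) (Sum.inr j) + m (Sum.inr j0) (Sum.inr j1)
      ≤ ∑ j ∈ S, ∑ i, m (Sum.inr i) (Sum.inr j) := by
    have h1 : ∑ j ∈ S, ∑ i ∈ insert j0 S, m (Sum.inr i) (Sum.inr j)
        ≤ ∑ j ∈ S, ∑ i, m (Sum.inr i) (Sum.inr j) :=
      Finset.sum_le_sum fun j _ => Finset.sum_le_univ_sum_of_nonneg fun i => p0 _ _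
    simp only [Finset.sum_insert hj0, Finset.sum_add_distrib] at h1
    have h2 : m (Sum.inr j0) (Sum.inr j1) ≤ ∑ j ∈ S, m (Sum.inr j0) (Sum.inr j) :=
      Finset.single_le_sum (f := fun j => m (Sum.inr j0) (Sum.inr j)) (fun v _ => p0 _ _) hj1
    linarith
  rw [Finset.sum_comm] at q4
  linarith

lemma push {X I J : Type*} [Fintype I] [Fintype J] (x : I → X) (y : J → X)
    (g : I → J → ℝ) (hg : ∀ i j, 0 ≤ g i j) (c : X → X → ℝ) :
    ∃ pl : (X × X) →₀ ℝ, (∀ p, 0 ≤ pl p) ∧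
      margFst pl = ∑ i, Finsupp.single (x i) (∑ j, g i j) ∧
      margSnd pl = ∑ j, Finsupp.single (y j) (∑ i, g i j) ∧
      ∑ p ∈ pl.support, pl p * c p.1 p.2 = ∑ i, ∑ j, g i j * c (x i) (y j) := by
  have key : ∀ {M : Type _} [AddCommMonoid M] (h : X × X → ℝ → M), (∀ p, h p 0 = 0) →
      (∀ p a b, h p (a + b) = h p a + h p b) →
      (∑ i, ∑ j, Finsupp.single (x i, y j) (g i j)).sum h = ∑ i, ∑ j, h (x i, y j) (g i j) := by
    intro M _ h h0 ha
    rw [← Finsupp.sum_finsetSum_index h0 ha]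
    refine Finset.sum_congr rfl fun i _ => ?_
    rw [← Finsupp.sum_finsetSum_index h0 ha]
    exact Finset.sum_congr rfl fun j _ => Finsupp.sum_single_index (h0 _)
  have key2 : ∀ (h : X × X → ℝ → ℝ), (∀ p, h p 0 = 0) →
      (∀ p a b, h p (a + b) = h p a + h p b) →
      (∑ i, ∑ j, Finsupp.single (x i, y j) (g i j)).sum h = ∑ i, ∑ j, h (x i, y j) (g i j) := by
    intro h h0 ha
    rw [← Finsupp.sum_finsetSum_index h0 ha]
    refine Finset.sum_congr rfl fun i _ => ?_
    rw [← Finsupp.sum_finsetSum_index h0 ha]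
    exact Finset.sum_congr rfl fun j _ => Finsupp.sum_single_index (h0 _)
  refine ⟨∑ i, ∑ j, Finsupp.single (x i, y j) (g i j), ?_, ?_, ?_, ?_⟩
  · intro p
    simp only [Finsupp.finsetSum_apply]
    refine Finset.sum_nonneg fun i _ => Finset.sum_nonneg fun j _ => ?_
    rw [Finsupp.single_apply]
    split_ifs
    · exact hg i j
    · exact le_rfl
  · rw [margFst, key _ (by simp) (by intros; simp)]
    refine Finset.sum_congr rfl fun i _ => ?_
    exact (Finsupp.single_finsetSum _ _ _).symm
  · rw [margSnd, key _ (by simp) (by intros; simp), Finset.sum_comm]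
    refine Finset.sum_congr rfl fun i _ => ?_
    exact (Finsupp.single_finsetSum _ _ _).symm
  · exact key2 (fun p w => w * c p.1 p.2) (by simp) (by intros; ring)

lemma share {X I : Type*} [Fintype I] (x : I → X) (w : I → ℝ)
    (P : Finset (X × X)) (pl : X × X → ℝ) (pr : X × X → X)
    (hw : ∀ i, 0 ≤ w i) (hpl : ∀ p ∈ P, 0 < pl p)
    (hm : ∀ z, ∑ p ∈ P, (if pr p = z then pl p else 0) = ∑ i, (if x i = z then w i else 0)) :
    ∃ a : I → X → ℝ, (∀ i z, 0 ≤ a i z) ∧ (∀ i z, a i z ≠ 0 → x i = z) ∧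
      (∀ p ∈ P, ∑ i, a i (pr p) = 1) ∧ (∀ i, ∑ p ∈ P, pl p * a i (pr p) = w i) := by
  let r : X → ℝ := fun z => ∑ i, (if x i = z then w i else 0)
  have r0 : ∀ z, 0 ≤ r z := fun z => Finset.sum_nonneg fun i _ => by
    split_ifs
    · exact hw i
    · exact le_rfl
  refine ⟨fun i z => if x i = z then w i / r z else 0, ?_, ?_, ?_, ?_⟩
  · intro i z
    simp only
    split_ifs
    · exact div_nonneg (hw i) (r0 z)
    · exact le_rfl
  · intro i z h
    by_contra hne
    simp [hne] at h
  · intro p hp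
    have hr : 0 < r (pr p) := by
      have h1 : pl p ≤ r (pr p) := by
        simp only [r]
        rw [← hm]
        have := Finset.single_le_sum (f := fun p' => if pr p' = pr p then pl p' else 0)
          (fun p' hp' => by
            split_ifs
            · exact (hpl p' hp').le
            · exact le_rfl) hp
        simpa using this
      exact (hpl p hp).trans_le h1
    have : ∀ i, (if x i = pr p then w i / r (pr p) else 0)
        = (if x i = pr p then w i else 0) / r (pr p) := by
      intro i; split_ifs <;> simp
    simp only [this, ← Finset.sum_div]
    exact div_self hr.ne'
  · intro i
    have h1 : ∀ p, pl p * (if x i = pr p then w i / r (pr p) else 0)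
        = (if pr p = x i then pl p else 0) * (w i / r (x i)) := by
      intro p
      by_cases h : x i = pr p
      · simp [h]
      · simp [h, Ne.symm h]
    simp only [h1, ← Finset.sum_mul]
    rw [hm]
    change r (x i) * _ = _
    have h2 : w i ≤ r (x i) := by
      have := Finset.single_le_sum (f := fun i' => if x i' = x i then w i' else 0)
        (fun p' hp' => by
            split_ifs
            · exact hw _
            · exact le_rfl) (Finset.mem_univ i)
      simpa using this
    by_cases hz : r (x i) = 0
    · have := hw i
      rw [hz]; linarith
    · field_simp

lemma lift_plan {X I J : Type*} [Fintype I] [Fintype J] (x : I → X) (y : J → X)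
    (w : I → ℝ) (w' : J → ℝ) (hw : ∀ i, 0 ≤ w i) (hw' : ∀ i, 0 ≤ w' i)
    (pl : (X × X) →₀ ℝ) (h0 : ∀ p, 0 ≤ pl p)
    (h1 : margFst pl = ∑ i, Finsupp.single (x i) (w i))
    (h2 : margSnd pl = ∑ i, Finsupp.single (y i) (w' i)) (c : X → X → ℝ) :
    ∃ g : I → J → ℝ, (∀ i j, 0 ≤ g i j) ∧ (∀ i, ∑ j, g i j = w i) ∧
      (∀ j, ∑ i, g i j = w' j) ∧
      ∑ i, ∑ j, g i j * c (x i) (y j) = ∑ p ∈ pl.support, pl p * c p.1 p.2 := by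
  have hpos : ∀ p ∈ pl.support, 0 < pl p := fun p hp =>
    lt_of_le_of_ne (h0 p) (Ne.symm (Finsupp.mem_support_iff.mp hp))
  obtain ⟨a, a0, ax, as, aw⟩ := share x w pl.support pl Prod.fst hw hpos (by
    intro z
    have := DFunLike.congr_fun h1 z
    simpa [margFst, Finsupp.sum, Finsupp.finsetSum_apply, Finsupp.single_apply] using this)
  obtain ⟨b, b0, bx, bs, bw⟩ := share y w' pl.support pl Prod.snd hw' hpos (by
    intro z
    have := DFunLike.congr_fun h2 z
    simpa [margSnd, Finsupp.sum, Finsupp.finsetSum_apply, Finsupp.single_apply] using this)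
  refine ⟨fun i j => ∑ p ∈ pl.support, pl p * a i p.1 * b j p.2, ?_, ?_, ?_, ?_⟩
  · intro i j
    exact Finset.sum_nonneg fun p _ => mul_nonneg (mul_nonneg (h0 p) (a0 _ _)) (b0 _ _)
  · intro i
    rw [Finset.sum_comm, ← aw i]
    refine Finset.sum_congr rfl fun p hp => ?_
    rw [← Finset.mul_sum, bs p hp, mul_one]
  · intro j
    rw [Finset.sum_comm, ← bw j]
    refine Finset.sum_congr rfl fun p hp => ?_
    rw [← Finset.sum_mul, ← Finset.mul_sum, as p hp, mul_one]
  · have e : ∀ i j, (∑ p ∈ pl.support, pl p * a i p.1 * b j p.2) * c (x i) (y j)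
        = ∑ p ∈ pl.support, pl p * c p.1 p.2 * (a i p.1 * b j p.2) := by
      intro i j
      rw [Finset.sum_mul]
      refine Finset.sum_congr rfl fun p _ => ?_
      by_cases ha : a i p.1 = 0
      · simp [ha]
      by_cases hb : b j p.2 = 0
      · simp [hb]
      rw [ax _ _ ha, bx _ _ hb]; ring
    simp only [e]
    have e2 : ∀ i, ∑ j, ∑ p ∈ pl.support, pl p * c p.1 p.2 * (a i p.1 * b j p.2)
        = ∑ p ∈ pl.support, pl p * c p.1 p.2 * a i p.1 := by
      intro i
      rw [Finset.sum_comm]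
      refine Finset.sum_congr rfl fun p hp => ?_
      rw [← Finset.mul_sum, ← Finset.mul_sum, bs p hp, mul_one]
    simp only [e2]
    rw [Finset.sum_comm]
    refine Finset.sum_congr rfl fun p hp => ?_
    rw [← Finset.mul_sum, as p hp, mul_one]

lemma rep {X : Type*} (l : X →₀ ℝ) :
    ∑ a : l.support, Finsupp.single (a : X) (l a) = l := by
  rw [Finset.sum_coe_sort l.support (fun a => Finsupp.single a (l a))]
  exact Finsupp.sum_single l

lemma rep_fin {X : Type*} [Inhabited X] (n : ℕ) (μ : X →₀ ℝ) (h0 : ∀ z, 0 ≤ μ z)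
    (h : μ.support.card ≤ n) :
    ∃ (z : Fin n → X) (α : Fin n → ℝ), (∀ j, 0 ≤ α j) ∧
      μ = ∑ j, Finsupp.single (z j) (α j) := by
  obtain ⟨e⟩ : Nonempty (μ.support ↪ Fin n) :=
    Function.Embedding.nonempty_of_card_le (by simpa using h)
  refine ⟨Function.extend e (fun s => (s : X)) (fun _ => default),
    Function.extend e (fun s => μ s) (fun _ => 0), ?_, ?_⟩
  · intro j
    by_cases hj : ∃ s, e s = j
    · obtain ⟨s, rfl⟩ := hj
      rw [e.injective.extend_apply]; exact h0 _
    · rw [Function.extend_apply' _ _ _ hj]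
  · conv_lhs => rw [← rep μ]
    refine Fintype.sum_of_injective e e.injective _ _ ?_ ?_
    · intro j hj
      rw [Function.extend_apply' (f := e) (g := fun s => μ s) _ _ (by simpa using hj)]
      simp
    · intro s
      rw [e.injective.extend_apply, e.injective.extend_apply]

lemma exists_plan {X : Type*} (μ ν : X →₀ ℝ) (hμ : ∀ z, 0 ≤ μ z) (hν : ∀ z, 0 ≤ ν z)
    (hb : (μ.sum fun _ a => a) = ν.sum fun _ a => a) :
    ∃ pl : (X × X) →₀ ℝ, (∀ p, 0 ≤ pl p) ∧ margFst pl = μ ∧ margSnd pl = ν := by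
  let M := μ.sum fun _ a => a
  have eμ : ∑ a : μ.support, μ a = M := Finset.sum_coe_sort μ.support (fun a => μ a)
  have eν : ∑ a : ν.support, ν a = M :=
    (Finset.sum_coe_sort ν.support (fun a => ν a)).trans hb.symm
  have hM : 0 ≤ M := Finset.sum_nonneg fun a _ => hμ a
  obtain ⟨pl, p0, p1, p2, -⟩ := push (fun a : μ.support => (a : X)) (fun a : ν.support => (a : X))
    (fun a b => μ a * ν b / M) (fun a b => div_nonneg (mul_nonneg (hμ _) (hν _)) hM)
    (fun _ _ => 0)
  have zμ : ∀ a : μ.support, μ a * M / M = μ a := by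
    intro a
    by_cases h : M = 0
    · have : μ a ≤ M := eμ ▸ Finset.single_le_sum (f := fun a : μ.support => μ a)
        (fun a _ => hμ a) (Finset.mem_univ a)
      have := hμ a
      rw [h] at *
      simp; linarith
    · field_simp
  have zν : ∀ a : ν.support, M * ν a / M = ν a := by
    intro a
    by_cases h : M = 0
    · have : ν a ≤ M := eν ▸ Finset.single_le_sum (f := fun a : ν.support => ν a)
        (fun a _ => hν a) (Finset.mem_univ a)
      have := hν a
      rw [h] at *
      simp; linarith
    · field_simp
  refine ⟨pl, p0, ?_, ?_⟩
  · rw [p1]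
    simp only [← Finset.sum_div, ← Finset.mul_sum, eν, zμ]
    exact rep μ
  · rw [p2]
    simp only [← Finset.sum_div, ← Finset.sum_mul, eμ, zν]
    exact rep ν

noncomputable def clamp {k : ℕ} (R : ℝ) (x : EuclideanSpace ℝ (Fin k)) :
    EuclideanSpace ℝ (Fin k) := WithLp.toLp 2 (fun i => max (-R) (min R (x i)))

lemma clamp_dist {k : ℕ} (R : ℝ) (x y : EuclideanSpace ℝ (Fin k)) :
    dist (clamp R x) (clamp R y) ≤ dist x y := by
  rw [EuclideanSpace.dist_eq, EuclideanSpace.dist_eq]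
  refine Real.sqrt_le_sqrt (Finset.sum_le_sum fun i _ => ?_)
  refine pow_le_pow_left₀ dist_nonneg ?_ 2
  simp only [clamp, Real.dist_eq]
  calc |max (-R) (min R (x i)) - max (-R) (min R (y i))|
      ≤ |min R (x i) - min R (y i)| := by
        rw [max_comm (-R), max_comm (-R)]; exact abs_max_sub_max_le_abs _ _ _
    _ ≤ |x i - y i| := by
        have := abs_inf_sub_inf_le_abs (x i) (y i) R
        rw [min_comm R, min_comm R]; exact this

lemma clamp_fix {k : ℕ} (R : ℝ) (x : EuclideanSpace ℝ (Fin k)) (h : ‖x‖ ≤ R) :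
    clamp R x = x := by
  ext i
  have h1 : |x i| ≤ R := (PiLp.norm_apply_le x i).trans h
  have := abs_le.mp h1
  simp [clamp, this.1, this.2]

end Aux15

/-- Lemma 1 of the paper: the infimum `inf_{μ ∈ B^{+,n}} W_q(μ+λ⁺, μ+λ⁻)`
is attained by some `μₙ ∈ B^{+,n}`. -/
theorem stmt_15 (q : ℝ) (hq : 1 < q) (k n : ℕ)
    (lp lm : EuclideanSpace ℝ (Fin k) →₀ ℝ)
    (hlp : ∀ z, 0 ≤ lp z) (hlm : ∀ z, 0 ≤ lm z)
    (hbal : (lp.sum fun _ a => a) = lm.sum fun _ a => a) :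
    ∃ μ : EuclideanSpace ℝ (Fin k) →₀ ℝ,
      (∀ z, 0 ≤ μ z) ∧ μ.support.card ≤ n ∧
      ∀ μ' : EuclideanSpace ℝ (Fin k) →₀ ℝ,
        (∀ z, 0 ≤ μ' z) → μ'.support.card ≤ n →
        WqCost q (μ + lp) (μ + lm) ^ (1 / q) ≤
          WqCost q (μ' + lp) (μ' + lm) ^ (1 / q) := by
  let A := {a // a ∈ lp.support}
  let B := {b // b ∈ lm.support}
  let la : A → ℝ := fun a => lp a
  let lb : B → ℝ := fun b => lm b
  let px : (Fin n → EuclideanSpace ℝ (Fin k)) → A ⊕ Fin n → EuclideanSpace ℝ (Fin k) :=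
    fun z => Sum.elim (fun a => (a : EuclideanSpace ℝ (Fin k))) z
  let py : (Fin n → EuclideanSpace ℝ (Fin k)) → B ⊕ Fin n → EuclideanSpace ℝ (Fin k) :=
    fun z => Sum.elim (fun a => (a : EuclideanSpace ℝ (Fin k))) z
  let F : (Fin n → EuclideanSpace ℝ (Fin k)) × ((A ⊕ Fin n) → (B ⊕ Fin n) → ℝ) → ℝ :=
    fun t => ∑ u, ∑ v, t.2 u v * dist (px t.1 u) (py t.1 v) ^ q
  let R : ℝ := ∑ a ∈ lp.support ∪ lm.support, ‖a‖
  let M : ℝ := ∑ a, la a + ∑ b, lb b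
  let C : Set (EuclideanSpace ℝ (Fin k)) :=
    WithLp.toLp 2 '' Set.Icc (fun _ : Fin k => -R) (fun _ => R)
  have hR0 : 0 ≤ R := Finset.sum_nonneg fun a _ => norm_nonneg a
  have hRb : ∀ a ∈ lp.support ∪ lm.support, ‖a‖ ≤ R := fun a ha =>
    Finset.single_le_sum (f := fun a => ‖a‖) (fun a _ => norm_nonneg a) ha
  have hC : IsCompact C := isCompact_Icc.image (PiLp.continuous_toLp 2 _)
  have hclampC : ∀ x, Aux15.clamp R x ∈ C := by
    intro x
    refine ⟨_, ⟨fun i => ?_, fun i => ?_⟩, rfl⟩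
    · exact le_max_left _ _
    · exact max_le (by simp only; linarith) (min_le_left _ _)
  let K : Set ((Fin n → EuclideanSpace ℝ (Fin k)) × ((A ⊕ Fin n) → (B ⊕ Fin n) → ℝ)) :=
    (Set.pi Set.univ fun _ => C) ×ˢ
      (Set.Icc 0 (fun _ _ => M) ∩ {g | Aux15.Feas la lb g})
  have hK : IsCompact K :=
    (isCompact_univ_pi fun _ => hC).prod
      (isCompact_Icc.inter_right (Aux15.isClosed_feas la lb))
  have hF : Continuous F := by
    refine continuous_finsetSum _ fun u _ => continuous_finsetSum _ fun v _ => ?_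
    have hpx : Continuous fun t : (Fin n → EuclideanSpace ℝ (Fin k)) ×
        ((A ⊕ Fin n) → (B ⊕ Fin n) → ℝ) => px t.1 u := by
      rcases u with a | j
      · exact continuous_const
      · exact (continuous_apply j).comp continuous_fst
    have hpy : Continuous fun t : (Fin n → EuclideanSpace ℝ (Fin k)) ×
        ((A ⊕ Fin n) → (B ⊕ Fin n) → ℝ) => py t.1 v := by
      rcases v with a | j
      · exact continuous_const
      · exact (continuous_apply j).comp continuous_fst
    have h1 : Continuous fun t : (Fin n → EuclideanSpace ℝ (Fin k)) ×
        ((A ⊕ Fin n) → (B ⊕ Fin n) → ℝ) => t.2 u v := by fun_prop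
    exact h1.mul ((hpx.dist hpy).rpow_const fun _ => Or.inr (by linarith))
  have hred : ∀ z g, Aux15.Feas la lb g → ∃ t ∈ K, F t ≤ F (z, g) := by
    intro z g hg
    obtain ⟨g', hg', hle, hM⟩ := Aux15.reduce la lb g hg
    refine ⟨(fun j => Aux15.clamp R (z j), g'),
      ⟨fun j _ => hclampC _, ⟨⟨fun u v => hg'.1 u v, fun u v => hM u v⟩, hg'⟩⟩, ?_⟩
    refine Finset.sum_le_sum fun u _ => Finset.sum_le_sum fun v _ => ?_
    have e1 : px (fun j => Aux15.clamp R (z j)) u = Aux15.clamp R (px z u) := by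
      rcases u with a | j
      · exact (Aux15.clamp_fix R _ (hRb _ (Finset.mem_union_left _ a.2))).symm
      · rfl
    have e2 : py (fun j => Aux15.clamp R (z j)) v = Aux15.clamp R (py z v) := by
      rcases v with a | j
      · exact (Aux15.clamp_fix R _ (hRb _ (Finset.mem_union_right _ a.2))).symm
      · rfl
    simp only [e1, e2]
    exact mul_le_mul (hle u v)
      (Real.rpow_le_rpow dist_nonneg (Aux15.clamp_dist R _ _) (by linarith))
      (Real.rpow_nonneg dist_nonneg _) (hg.1 u v)
  have hlift : ∀ μ' : EuclideanSpace ℝ (Fin k) →₀ ℝ, (∀ z, 0 ≤ μ' z) → μ'.support.card ≤ n →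
      ∀ pl : (EuclideanSpace ℝ (Fin k) × EuclideanSpace ℝ (Fin k)) →₀ ℝ, (∀ p, 0 ≤ pl p) →
      margFst pl = μ' + lp → margSnd pl = μ' + lm →
      ∃ t ∈ K, F t ≤ ∑ p ∈ pl.support, pl p * dist p.1 p.2 ^ q := by
    intro μ' h0 hc pl p0 p1 p2
    obtain ⟨z, α, hα, hμ⟩ := Aux15.rep_fin n μ' h0 hc
    obtain ⟨g, g0, g1, g2, g3⟩ := Aux15.lift_plan (px z) (py z)
      (Sum.elim la α) (Sum.elim lb α)
      (by rintro (a | j); exacts [hlp _, hα _])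
      (by rintro (a | j); exacts [hlm _, hα _]) pl p0
      (by
        rw [p1, Fintype.sum_sum_type, add_comm, hμ]
        congr 1
        exact (Aux15.rep lp).symm)
      (by
        rw [p2, Fintype.sum_sum_type, add_comm, hμ]
        congr 1
        exact (Aux15.rep lm).symm) (fun x y => dist x y ^ q)
    obtain ⟨t, ht, hle⟩ := hred z g ⟨g0, fun a => g1 (Sum.inl a), fun b => g2 (Sum.inl b),
      fun j => (g1 (Sum.inr j)).trans (g2 (Sum.inr j)).symm⟩
    exact ⟨t, ht, hle.trans g3.le⟩
  have hplan : ∀ μ' : EuclideanSpace ℝ (Fin k) →₀ ℝ, (∀ z, 0 ≤ μ' z) →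
      ∃ pl : (EuclideanSpace ℝ (Fin k) × EuclideanSpace ℝ (Fin k)) →₀ ℝ, (∀ p, 0 ≤ pl p) ∧
      margFst pl = μ' + lp ∧ margSnd pl = μ' + lm := by
    intro μ' h0
    refine Aux15.exists_plan _ _ (fun z => add_nonneg (h0 z) (hlp z))
      (fun z => add_nonneg (h0 z) (hlm z)) ?_
    rw [Finsupp.sum_add_index' (by simp) (by simp), Finsupp.sum_add_index' (by simp) (by simp),
      hbal]
  have hne : K.Nonempty := by
    obtain ⟨pl, p0, p1, p2⟩ := hplan 0 (by simp)
    obtain ⟨t, ht, -⟩ := hlift 0 (by simp) (by simp) pl p0 p1 p2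
    exact ⟨t, ht⟩
  obtain ⟨⟨z, g⟩, ⟨-, -, hg⟩, hmin⟩ := hK.exists_isMinOn hne hF.continuousOn
  obtain ⟨g0, g1, g2, g3⟩ := hg
  let μ : EuclideanSpace ℝ (Fin k) →₀ ℝ :=
    ∑ j, Finsupp.single (z j) (∑ v, g (Sum.inr j) v)
  have hcost : WqCost q (μ + lp) (μ + lm) ≤ F (z, g) := by
    obtain ⟨pl, p0, p1, p2, p3⟩ := Aux15.push (px z) (py z) g g0 (fun x y => dist x y ^ q)
    refine csInf_le ⟨0, ?_⟩ ⟨pl, p0, ?_, ?_, p3.symm⟩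
    · rintro c ⟨pl, p0, -, -, rfl⟩
      exact Finset.sum_nonneg fun p _ => mul_nonneg (p0 p) (Real.rpow_nonneg dist_nonneg _)
    · rw [p1, Fintype.sum_sum_type, add_comm]
      congr 1
      simp only [g1]
      exact Aux15.rep lp
    · rw [p2, Fintype.sum_sum_type, add_comm]
      congr 1
      · simp only [← g3]
        rfl
      · simp only [g2]
        exact Aux15.rep lm
  refine ⟨μ, ?_, ?_, ?_⟩
  · intro x
    simp only [μ, Finsupp.finsetSum_apply]
    refine Finset.sum_nonneg fun j _ => ?_
    rw [Finsupp.single_apply]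
    split_ifs
    · exact Finset.sum_nonneg fun v _ => g0 _ _
    · exact le_rfl
  · have hs : μ.support ⊆ Finset.univ.image z := by
      intro x hx
      by_contra hne'
      apply Finsupp.mem_support_iff.mp hx
      simp only [μ, Finsupp.finsetSum_apply]
      refine Finset.sum_eq_zero fun j _ => ?_
      rw [Finsupp.single_apply, if_neg]
      rintro rfl
      exact hne' (Finset.mem_image_of_mem _ (Finset.mem_univ j))
    calc μ.support.card ≤ (Finset.univ.image z).card := Finset.card_le_card hs
      _ ≤ (Finset.univ : Finset (Fin n)).card := Finset.card_image_le
      _ = n := by simp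
  · intro μ' h0 hc
    refine Real.rpow_le_rpow ?_ ?_ (by positivity)
    · refine Real.sInf_nonneg ?_
      rintro c ⟨pl, p0, -, -, rfl⟩
      exact Finset.sum_nonneg fun p _ => mul_nonneg (p0 p) (Real.rpow_nonneg dist_nonneg _)
    · refine hcost.trans (le_csInf ?_ ?_)
      · obtain ⟨pl, p0, p1, p2⟩ := hplan μ' h0
        exact ⟨_, pl, p0, p1, p2, rfl⟩
      · rintro c ⟨pl, p0, p1, p2, rfl⟩
        obtain ⟨t, ht, hle⟩ := hlift μ' h0 hc pl p0 p1 p2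
        exact (hmin ht).trans hle
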